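/- arXiv:0911.3305 — 10 statements merged into one kernel-verified Lean document; each statement's English description precedes it below -/
import Mathlib

section
/- The monoid M_Bii is cancellative: for all elements A, X, Y, B of M_Bii, if A·X·B = A·Y·B then X = Y. (In particular M_Bii satisfies both the left and the right cancellation conditions.) -/
/-- The three generators of the monoid `M_Bii`. -/
inductive BiiGen : Type
  | a | b | c

open FreeMonoid in
/-- The positive homogeneous relations `cbb = bba`, `bc = ab`, `ac = ca`. -/
def biiRel : FreeMonoid BiiGen → FreeMonoid BiiGen → Prop := fun x y =>
  (x = of .c * of .b * of .b ∧ y = of .b * of .b * of .a) ∨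
  (x = of .b * of .c ∧ y = of .a * of .b) ∨
  (x = of .a * of .c ∧ y = of .c * of .a)

/-- The monoid `M_Bii`: quotient of the free monoid on `{a,b,c}` by the congruence
generated by the relations `cbb = bba`, `bc = ab`, `ac = ca`. -/
abbrev MBii : Type := (conGen biiRel).Quotient

/-- The image of the generator `a` in `M_Bii`. -/
def MBii.a : MBii := (conGen biiRel).mk' (FreeMonoid.of BiiGen.a)
/-- The image of the generator `b` in `M_Bii`. -/
def MBii.b : MBii := (conGen biiRel).mk' (FreeMonoid.of BiiGen.b)
/-- The image of the generator `c` in `M_Bii`. -/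
def MBii.c : MBii := (conGen biiRel).mk' (FreeMonoid.of BiiGen.c)

namespace MBii

lemma c_mul_b_mul_b : c * b * b = b * b * a :=
  Quotient.sound (ConGen.Rel.of _ _ (Or.inl ⟨rfl, rfl⟩))

lemma b_mul_c : b * c = a * b :=
  Quotient.sound (ConGen.Rel.of _ _ (Or.inr (Or.inl ⟨rfl, rfl⟩)))

lemma a_mul_c : a * c = c * a :=
  Quotient.sound (ConGen.Rel.of _ _ (Or.inr (Or.inr ⟨rfl, rfl⟩)))

lemma commute_a_c : Commute a c := a_mul_c

lemma b_mul_c_pow (j : ℕ) : b * c ^ j = a ^ j * b :=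
  SemiconjBy.pow_right (show SemiconjBy b c a from b_mul_c) j

lemma semiconjBy_b_a_pow_b (i : ℕ) : SemiconjBy (b * a ^ i * b) a c := by
  induction i with
  | zero => simpa [SemiconjBy, mul_assoc] using c_mul_b_mul_b.symm
  | succ i ih =>
    have h : b * a ^ (i + 1) * b = b * a ^ i * b * c := by
      simp only [pow_succ, mul_assoc, b_mul_c]
    rw [h]
    exact ih.mul_left commute_a_c.symm

/-- Every element of `M_Bii` is of the form `aⁱcʲ` or `aⁱcʲ b aˡbᵏ`. -/
lemma exists_normal_form (x : MBii) :
    (∃ i j : ℕ, x = a ^ i * c ^ j) ∨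
      ∃ i j l k : ℕ, x = a ^ i * c ^ j * (b * a ^ l * b ^ k) := by
  obtain ⟨w, rfl⟩ := Con.mk'_surjective x
  induction w using FreeMonoid.inductionOn' with
  | one => exact Or.inl ⟨0, 0, by simp⟩
  | of_mul g w ih =>
    rw [map_mul]
    generalize (conGen biiRel).mk' w = y at ih ⊢
    have hc (i j : ℕ) : c * (a ^ i * c ^ j) = a ^ i * c ^ (j + 1) := by
      rw [← mul_assoc, ← (commute_a_c.pow_left i).eq, mul_assoc, pow_succ']
    have hb (i j : ℕ) : b * (a ^ i * c ^ j) = a ^ j * (b * a ^ i) := by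
      rw [(commute_a_c.pow_pow i j).eq, ← mul_assoc, b_mul_c_pow, mul_assoc]
    cases g with
    | a =>
      change (∃ i j : ℕ, a * y = _) ∨ ∃ i j l k : ℕ, a * y = _
      rcases ih with ⟨i, j, rfl⟩ | ⟨i, j, l, k, rfl⟩
      · exact Or.inl ⟨i + 1, j, by simp only [pow_succ', mul_assoc]⟩
      · exact Or.inr ⟨i + 1, j, l, k, by simp only [pow_succ' a i, mul_assoc]⟩
    | b =>
      change (∃ i j : ℕ, b * y = _) ∨ ∃ i j l k : ℕ, b * y = _
      rcases ih with ⟨i, j, rfl⟩ | ⟨i, j, l, k, rfl⟩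
      · exact Or.inr ⟨j, 0, i, 0, by simp [hb]⟩
      · refine Or.inr ⟨j, l, i, k + 1, ?_⟩
        calc b * (a ^ i * c ^ j * (b * a ^ l * b ^ k))
            = a ^ j * (b * a ^ i * b * a ^ l) * b ^ k := by
              rw [← mul_assoc, hb]; simp only [mul_assoc]
          _ = a ^ j * c ^ l * (b * a ^ i * b ^ (k + 1)) := by
              rw [((semiconjBy_b_a_pow_b i).pow_right l).eq, pow_succ']
              simp only [mul_assoc]
    | c =>
      change (∃ i j : ℕ, c * y = _) ∨ ∃ i j l k : ℕ, c * y = _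
      rcases ih with ⟨i, j, rfl⟩ | ⟨i, j, l, k, rfl⟩
      · exact Or.inl ⟨i, j + 1, hc i j⟩
      · exact Or.inr ⟨i, j + 1, l, k, by rw [← mul_assoc, hc]⟩

/-- The permutations of `ℤ⁴` by which the generators act, modelled on the left regular action of
`ℤ³ ⋊ ℤ`, where `b` permutes the coordinates of `ℤ³` cyclically. -/
def genPerm : BiiGen → Equiv.Perm (ℤ × ℤ × ℤ × ℤ)
  | .a =>
    { toFun := fun p => (p.1 + 1, p.2.1, p.2.2.1, p.2.2.2)
      invFun := fun p => (p.1 - 1, p.2.1, p.2.2.1, p.2.2.2)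
      left_inv := fun p => by simp
      right_inv := fun p => by simp }
  | .b =>
    { toFun := fun p => (p.2.1, p.2.2.1, p.1, p.2.2.2 + 1)
      invFun := fun p => (p.2.2.1, p.1, p.2.1, p.2.2.2 - 1)
      left_inv := fun p => by simp
      right_inv := fun p => by simp }
  | .c =>
    { toFun := fun p => (p.1, p.2.1 + 1, p.2.2.1, p.2.2.2)
      invFun := fun p => (p.1, p.2.1 - 1, p.2.2.1, p.2.2.2)
      left_inv := fun p => by simp
      right_inv := fun p => by simp }

/-- The homomorphism from `M_Bii` to the permutations of `ℤ⁴`. -/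
def toPerm : MBii →* Equiv.Perm (ℤ × ℤ × ℤ × ℤ) :=
  (conGen biiRel).lift (FreeMonoid.lift genPerm) <| Con.conGen_le.2 <| by
    rintro x y (⟨rfl, rfl⟩ | ⟨rfl, rfl⟩ | ⟨rfl, rfl⟩) <;> exact Equiv.ext fun _ => rfl

lemma toPerm_a (i j l k : ℤ) : toPerm a (i, j, l, k) = (i + 1, j, l, k) := rfl

lemma toPerm_b (i j l k : ℤ) : toPerm b (i, j, l, k) = (j, l, i, k + 1) := rfl

lemma toPerm_c (i j l k : ℤ) : toPerm c (i, j, l, k) = (i, j + 1, l, k) := rfl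

lemma toPerm_a_pow (n : ℕ) (i j l k : ℤ) :
    toPerm (a ^ n) (i, j, l, k) = (i + n, j, l, k) := by
  induction n with
  | zero => simp
  | succ n ih => rw [pow_succ', map_mul, Equiv.Perm.mul_apply, ih, toPerm_a]; simp [add_assoc]

lemma toPerm_c_pow (n : ℕ) (i j l k : ℤ) :
    toPerm (c ^ n) (i, j, l, k) = (i, j + n, l, k) := by
  induction n with
  | zero => simp
  | succ n ih => rw [pow_succ', map_mul, Equiv.Perm.mul_apply, ih, toPerm_c]; simp [add_assoc]

lemma toPerm_b_pow_zero (n : ℕ) : toPerm (b ^ n) (0, 0, 0, 0) = (0, 0, 0, (n : ℤ)) := by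
  induction n with
  | zero => simp
  | succ n ih => rw [pow_succ', map_mul, Equiv.Perm.mul_apply, ih, toPerm_b]; simp

lemma toPerm_a_pow_mul_c_pow (i j : ℕ) :
    toPerm (a ^ i * c ^ j) (0, 0, 0, 0) = ((i : ℤ), (j : ℤ), 0, 0) := by
  rw [map_mul, Equiv.Perm.mul_apply, toPerm_c_pow, toPerm_a_pow]
  simp

lemma toPerm_normal_form (i j l k : ℕ) :
    toPerm (a ^ i * c ^ j * (b * a ^ l * b ^ k)) (0, 0, 0, 0) =
      ((i : ℤ), (j : ℤ), (l : ℤ), (k : ℤ) + 1) := by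
  simp only [map_mul toPerm, Equiv.Perm.mul_apply, toPerm_b_pow_zero, toPerm_c_pow, toPerm_a_pow,
    toPerm_b, zero_add]

lemma toPerm_injective : Function.Injective toPerm := by
  intro x y hxy
  have h := congrArg (fun f => f (0, 0, 0, 0)) hxy
  rcases exists_normal_form x with ⟨i, j, rfl⟩ | ⟨i, j, l, k, rfl⟩ <;>
    rcases exists_normal_form y with ⟨i', j', rfl⟩ | ⟨i', j', l', k', rfl⟩ <;>
    simp only [toPerm_a_pow_mul_c_pow, toPerm_normal_form, Prod.mk.injEq] at h
  · obtain rfl : i = i' := by omega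
    obtain rfl : j = j' := by omega
    rfl
  · omega
  · omega
  · obtain rfl : i = i' := by omega
    obtain rfl : j = j' := by omega
    obtain rfl : l = l' := by omega
    obtain rfl : k = k' := by omega
    rfl

end MBii

/-- The monoid `M_Bii` is cancellative. -/
theorem MBii_cancellative : ∀ A X Y B : MBii, A * X * B = A * Y * B → X = Y := by
  intro A X Y B h
  apply MBii.toPerm_injective
  have h' := congrArg MBii.toPerm h
  simpa only [map_mul, mul_left_inj, mul_right_inj] using h'
end

section
/- There is a group isomorphism between the group presented by generators a, b, c with relations a·b·a·b·a·b = b·a·b·a·b·a, b·c = a·b, a·c = c·a and the group presented by generators a, b, c with relations c·b·b = b·b·a, b·c = a·b, a·c = c·a, which sends each generator a, b, c of the first group to the generator of the same name in the second group. -/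
open FreeGroup in
/-- Relations `ababab = bababa`, `bc = ab`, `ac = ca` as elements of the free group. -/
def biiRelsZvK : Set (FreeGroup BiiGen) :=
  { of .a * of .b * of .a * of .b * of .a * of .b *
      (of .b * of .a * of .b * of .a * of .b * of .a)⁻¹,
    of .b * of .c * (of .a * of .b)⁻¹,
    of .a * of .c * (of .c * of .a)⁻¹ }

open FreeGroup in
/-- Relations `cbb = bba`, `bc = ab`, `ac = ca` as elements of the free group. -/
def biiRelsPos : Set (FreeGroup BiiGen) :=
  { of .c * of .b * of .b * (of .b * of .b * of .a)⁻¹,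
    of .b * of .c * (of .a * of .b)⁻¹,
    of .a * of .c * (of .c * of .a)⁻¹ }

namespace BiiGen

section

variable {G : Type*} [Group G] {a b c : G}

/-- If `bc = ab` and `ac = ca`, then `a` commutes with its conjugate by `b`. -/
theorem commute_conj (hbc : b * c = a * b) (hac : a * c = c * a) :
    Commute a (b * a * b⁻¹) := by
  have hc : b * c * b⁻¹ = a := by rw [hbc, mul_inv_cancel_right]
  have h : Commute (b * c * b⁻¹) (b * a * b⁻¹) :=
    Commute.conj_iff b |>.2 (show Commute a c from hac).symm
  rwa [hc] at h

/-- Modulo `bc = ab` and `ac = ca`, the relations `ababab = bababa` and `cbb = bba` are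
equivalent. With `xᵢ = bⁱab⁻ⁱ`, they read `x₀x₁x₂ = x₁x₂x₃` and `x₀ = x₃`. -/
theorem hexagon_iff (hbc : b * c = a * b) (hac : a * c = c * a) :
    a * b * a * b * a * b = b * a * b * a * b * a ↔ c * b * b = b * b * a := by
  obtain ⟨x, hx⟩ : ∃ x, x = b * a * b⁻¹ := ⟨_, rfl⟩
  obtain ⟨y, hy⟩ : ∃ y, y = b * x * b⁻¹ := ⟨_, rfl⟩
  obtain ⟨z, hz⟩ : ∃ z, z = b * y * b⁻¹ := ⟨_, rfl⟩
  have hax : Commute a x := hx ▸ commute_conj hbc hac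
  have hxy : Commute x y := by
    have h := (Commute.conj_iff b).2 hax
    rwa [← hx, ← hy] at h
  have hyz : Commute y z := by
    have h := (Commute.conj_iff b).2 hxy
    rwa [← hy, ← hz] at h
  have hleft : a * b * a * b * a * b = x * (a * y) * (b * b * b) := by
    rw [← mul_assoc x, ← hax.eq, hy, hx]; group
  have hright : b * a * b * a * b * a = x * (y * z) * (b * b * b) := by
    rw [hz, hy, hx]; group
  have hc : c = b⁻¹ * a * b := by rw [mul_assoc, ← hbc, inv_mul_cancel_left]
  have hpos : c * b * b = b * b * a ↔ a = z := by
    have h₁ : c * b * b = b⁻¹ * a * (b * b * b) := by rw [hc]; group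
    have h₂ : b * b * a = b⁻¹ * z * (b * b * b) := by rw [hz, hy, hx]; group
    rw [h₁, h₂, mul_left_inj, mul_right_inj]
  rw [hleft, hright, hpos, mul_left_inj, mul_right_inj]
  constructor
  · intro h
    exact mul_right_cancel (h.trans hyz.eq)
  · rintro rfl
    exact hyz.eq.symm

end

section

variable {G : Type*} [Group G]

theorem lift_biiRelsZvK_eq_one_iff (f : BiiGen → G) :
    (∀ r ∈ biiRelsZvK, FreeGroup.lift f r = 1) ↔
      f a * f b * f a * f b * f a * f b = f b * f a * f b * f a * f b * f a ∧
        f b * f c = f a * f b ∧ f a * f c = f c * f a := by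
  simp only [biiRelsZvK, Set.forall_mem_insert, Set.mem_singleton_iff, forall_eq, map_mul,
    map_inv, FreeGroup.lift_apply_of, mul_inv_eq_one]

theorem lift_biiRelsPos_eq_one_iff (f : BiiGen → G) :
    (∀ r ∈ biiRelsPos, FreeGroup.lift f r = 1) ↔
      f c * f b * f b = f b * f b * f a ∧ f b * f c = f a * f b ∧ f a * f c = f c * f a := by
  simp only [biiRelsPos, Set.forall_mem_insert, Set.mem_singleton_iff, forall_eq, map_mul,
    map_inv, FreeGroup.lift_apply_of, mul_inv_eq_one]

/-- A map from the generators to a group respects one set of relations iff it respects the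
other. -/
theorem lift_biiRelsZvK_iff_lift_biiRelsPos (f : BiiGen → G) :
    (∀ r ∈ biiRelsZvK, FreeGroup.lift f r = 1) ↔ ∀ r ∈ biiRelsPos, FreeGroup.lift f r = 1 := by
  rw [lift_biiRelsZvK_eq_one_iff, lift_biiRelsPos_eq_one_iff]
  exact and_congr_left fun h => hexagon_iff h.1 h.2

end

theorem lift_of_eq_one {rels : Set (FreeGroup BiiGen)} :
    ∀ r ∈ rels, FreeGroup.lift (PresentedGroup.of (rels := rels)) r = 1 := by
  intro r hr
  have h : FreeGroup.lift (PresentedGroup.of (rels := rels)) = PresentedGroup.mk rels := by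
    ext; simp [PresentedGroup.of]
  rw [h]
  exact PresentedGroup.one_of_mem hr

end BiiGen

/-- The two presentations define isomorphic groups, generator by generator. -/
theorem Bii_presentations_isomorphic :
    ∃ e : PresentedGroup biiRelsZvK ≃* PresentedGroup biiRelsPos,
      e (PresentedGroup.of BiiGen.a) = PresentedGroup.of BiiGen.a ∧
      e (PresentedGroup.of BiiGen.b) = PresentedGroup.of BiiGen.b ∧
      e (PresentedGroup.of BiiGen.c) = PresentedGroup.of BiiGen.c := by
  let f := PresentedGroup.toGroup
    ((BiiGen.lift_biiRelsZvK_iff_lift_biiRelsPos _).2 (BiiGen.lift_of_eq_one (rels := biiRelsPos)))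
  let g := PresentedGroup.toGroup
    ((BiiGen.lift_biiRelsZvK_iff_lift_biiRelsPos _).1 (BiiGen.lift_of_eq_one (rels := biiRelsZvK)))
  refine ⟨f.toMulEquiv g ?_ ?_, ?_, ?_, ?_⟩
  · ext x
    simp [f, g]
  · ext x
    simp [f, g]
  all_goals simp [f]
end

section
/- In the group G_Bvi, the following relations hold: a·c·b = c·a·c, b·c·b = c·b·c, c·a·b = b·c·a, a·b·b = b·b·c, and a^5 = b^5 = c^5. -/
/-- The three generators. -/
inductive BGen : Type
  | a | b | c

open FreeGroup in
/-- The relations `aba = bab`, `aca = bac`, `acaca = cacac` of `G_Bvi`. -/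
def bviRels : Set (FreeGroup BGen) :=
  { of .a * of .b * of .a * (of .b * of .a * of .b)⁻¹,
    of .a * of .c * of .a * (of .b * of .a * of .c)⁻¹,
    of .a * of .c * of .a * of .c * of .a * (of .c * of .a * of .c * of .a * of .c)⁻¹ }

/-- The group `G_Bvi`. -/
abbrev GBvi : Type := PresentedGroup bviRels

namespace GBvi
def a : GBvi := PresentedGroup.of BGen.a
def b : GBvi := PresentedGroup.of BGen.b
def c : GBvi := PresentedGroup.of BGen.c
end GBvi

section

variable {G : Type*} [Group G] {a b c : G}

/-- In a group with `bac = aca` and `acaca = cacac`, the element `ac` conjugates `b` to `c`. -/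
lemma mul_mul_eq_of_conj (hac : a * c * a = b * a * c)
    (hc : a * c * a * c * a = c * a * c * a * c) : a * c * b = c * a * c := by
  have hb : b = a * c * a * (a * c)⁻¹ := by rw [hac]; group
  calc a * c * b = a * c * a * c * a * (a * c)⁻¹ := by rw [hb]; group
    _ = c * a * c := by rw [hc]; group

/-- Conjugation by `ac` carries the braid relation of `a, b` to that of `b, c`. -/
lemma braid_of_conj (hab : a * b * a = b * a * b) (hac : a * c * a = b * a * c)
    (hcb : a * c * b = c * a * c) : b * c * b = c * b * c := by
  have hb : b = a * c * a * (a * c)⁻¹ := by rw [hac]; group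
  have hc : c = a * c * b * (a * c)⁻¹ := by rw [hcb]; group
  calc b * c * b
      = a * c * a * (a * c)⁻¹ * (a * c * b * (a * c)⁻¹) * (a * c * a * (a * c)⁻¹) := by
        rw [← hb, ← hc]
    _ = a * c * (a * b * a) * (a * c)⁻¹ := by group
    _ = a * c * b * (a * c)⁻¹ * (a * c * a * (a * c)⁻¹) * (a * c * b * (a * c)⁻¹) := by
        rw [hab]; group
    _ = c * b * c := by rw [← hb, ← hc]

lemma rotate_of_braid (hab : a * b * a = b * a * b) (hac : a * c * a = b * a * c)
    (hcb : a * c * b = c * a * c) (hbc : b * c * b = c * b * c) : c * a * b = b * c * a := by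
  have h : a * (c * a * b) * c = a * (b * c * a) * c := by
    calc a * (c * a * b) * c = a * c * a * (b * c) := by group
      _ = b * a * (c * b * c) := by rw [hac]; group
      _ = b * a * b * (c * b) := by rw [← hbc]; group
      _ = a * b * (a * c * b) := by rw [← hab]; group
      _ = a * (b * c * a) * c := by rw [hcb]; group
  exact mul_left_cancel (mul_right_cancel h)

lemma mul_sq_of_rotate (hab : a * b * a = b * a * b) (hbc : b * c * b = c * b * c)
    (hcab : c * a * b = b * c * a) : a * b * b = b * b * c := by
  have hconj_inv : b⁻¹ * a * b = a * b * a⁻¹ :=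
    calc b⁻¹ * a * b = b⁻¹ * (a * b * a) * a⁻¹ := by group
      _ = a * b * a⁻¹ := by rw [hab]; group
  refine mul_left_cancel (a := c) ?_
  calc c * (a * b * b) = c * a * b * b := by group
    _ = b * c * b * (b⁻¹ * a * b) := by rw [hcab]; group
    _ = c * b * (c * a * b) * a⁻¹ := by rw [hbc, hconj_inv]; group
    _ = c * (b * b * c) := by rw [hcab]; group

lemma commute_pow_five (hab : a * b * a = b * a * b) (hac : a * c * a = b * a * c)
    (habb : a * b * b = b * b * c) : b * a ^ 5 = a ^ 5 * b := by
  have hc : c = b⁻¹ * b⁻¹ * (a * b * b) := by rw [habb]; group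
  have hconj : b * a * b⁻¹ = a⁻¹ * b * a :=
    calc b * a * b⁻¹ = a⁻¹ * (a * b * a) * b⁻¹ := by group
      _ = a⁻¹ * b * a := by rw [hab]; group
  have hconj_inv : b⁻¹ * a * b = a * b * a⁻¹ :=
    calc b⁻¹ * a * b = b⁻¹ * (a * b * a) * a⁻¹ := by group
      _ = a * b * a⁻¹ := by rw [hab]; group
  have hleft : b * a * c = a⁻¹ * a⁻¹ * a⁻¹ * b * a * a * a * b * a :=
    calc b * a * c = b * a * b⁻¹ * b⁻¹ * a * b * b := by rw [hc]; group
      _ = a⁻¹ * b * a * b⁻¹ * a * b * b := by rw [hconj]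
      _ = a⁻¹ * (b * a * b⁻¹) * a * b * b := by group
      _ = a⁻¹ * a⁻¹ * b * a * a * b * b := by rw [hconj]; group
      _ = a⁻¹ * a⁻¹ * b * a * b⁻¹ * (b * a * b) * b := by group
      _ = a⁻¹ * a⁻¹ * b * a * b⁻¹ * (a * b * a) * b := by rw [hab]
      _ = a⁻¹ * a⁻¹ * (b * a * b⁻¹) * a * (b * a * b) := by group
      _ = a⁻¹ * a⁻¹ * a⁻¹ * b * a * a * a * b * a := by rw [hconj, ← hab]; group
  have hright : a * c * a = a * a * b * a⁻¹ * a⁻¹ * b * a :=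
    calc a * c * a = a * b⁻¹ * (b⁻¹ * a * b) * b * a := by rw [hc]; group
      _ = a * b⁻¹ * (a * b * a⁻¹) * b * a := by rw [hconj_inv]
      _ = a * (b⁻¹ * a * b) * a⁻¹ * b * a := by group
      _ = a * a * b * a⁻¹ * a⁻¹ * b * a := by rw [hconj_inv]; group
  rw [hleft, hright] at hac
  calc b * a ^ 5
      = a ^ 3 * (a⁻¹ * a⁻¹ * a⁻¹ * b * a * a * a * b * a) * (b * a)⁻¹ * a ^ 2 := by group
    _ = a ^ 5 * b := by rw [← hac]; group

/-- An element `g` conjugating `a` to `b` and commuting with `a ^ n` forces `a ^ n = b ^ n`. -/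
lemma pow_eq_pow_of_semiconj {g : G} {n : ℕ} (h : g * a = b * g)
    (hg : g * a ^ n = a ^ n * g) : a ^ n = b ^ n :=
  mul_right_cancel (hg.symm.trans (SemiconjBy.pow_right (show SemiconjBy g a b from h) n))

end

open GBvi in
theorem GBvi_relations :
    a * c * b = c * a * c ∧ b * c * b = c * b * c ∧ c * a * b = b * c * a ∧
    a * b * b = b * b * c ∧ a ^ 5 = b ^ 5 ∧ b ^ 5 = c ^ 5 := by
  have hab : a * b * a = b * a * b :=
    mul_inv_eq_one.mp (PresentedGroup.one_of_mem (rels := bviRels) (.inl rfl))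
  have hac : a * c * a = b * a * c :=
    mul_inv_eq_one.mp (PresentedGroup.one_of_mem (rels := bviRels) (.inr (.inl rfl)))
  have hc : a * c * a * c * a = c * a * c * a * c :=
    mul_inv_eq_one.mp (PresentedGroup.one_of_mem (rels := bviRels) (.inr (.inr rfl)))
  have hcb := mul_mul_eq_of_conj hac hc
  have hbc := braid_of_conj hab hac hcb
  have hcab := rotate_of_braid hab hac hcb hbc
  have habb := mul_sq_of_rotate hab hbc hcab
  have hcomm := commute_pow_five hab hac habb
  have h5 : a ^ 5 = b ^ 5 :=
    pow_eq_pow_of_semiconj (g := a * b) (by rw [hab, mul_assoc])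
      ((Commute.self_pow a 5).mul_left hcomm)
  have hc5 : b * b * c ^ 5 = a ^ 5 * (b * b) :=
    SemiconjBy.pow_right (show b * b * c = a * (b * b) by rw [← habb, mul_assoc]) 5
  refine ⟨hcb, hbc, hcab, habb, h5, ?_⟩
  rw [h5, ((Commute.self_pow b 5).mul_left (Commute.self_pow b 5)).eq.symm] at hc5
  exact (mul_left_cancel hc5).symm
end

section
/- In the group G_Hiii, the following relations hold: b·c·a = c·b·c, a·c·a = c·a·c, a·a·c = b·a·a, a·c·c·b = b·c·a·a, and a^5 = b^5 = c^5. -/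
/-- The three generators. -/
inductive HGen : Type
  | a | b | c

open FreeGroup in
/-- The relations `aba = bab`, `bcba = cbac`, `cba = acb` of `G_Hiii`. -/
def hiiiRels : Set (FreeGroup HGen) :=
  { of .a * of .b * of .a * (of .b * of .a * of .b)⁻¹,
    of .b * of .c * of .b * of .a * (of .c * of .b * of .a * of .c)⁻¹,
    of .c * of .b * of .a * (of .a * of .c * of .b)⁻¹ }

/-- The group `G_Hiii`. -/
abbrev GHiii : Type := PresentedGroup hiiiRels

namespace GHiii
def a : GHiii := PresentedGroup.of HGen.a
def b : GHiii := PresentedGroup.of HGen.b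
def c : GHiii := PresentedGroup.of HGen.c
end GHiii

section TwoGenerators

variable {G : Type*} [Group G] {x d : G}

/-- If `x ^ 2` commutes with `d`, then `d ^ 3 x d ^ 3 = x ^ 3 d ^ 2 x` can be solved for `d ^ 2`. -/
theorem mul_cube_mul_cube_mul (hz : Commute (x ^ 2) d)
    (h : d ^ 3 * x * d ^ 3 = x ^ 3 * d ^ 2 * x) :
    x * d ^ 3 * x * d ^ 3 * x = x ^ 6 * d ^ 2 :=
  calc x * d ^ 3 * x * d ^ 3 * x = x * (d ^ 3 * x * d ^ 3) * x := by group
    _ = x ^ 4 * (d ^ 2 * x ^ 2) := by rw [h]; simp [pow_succ, mul_assoc]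
    _ = x ^ 6 * d ^ 2 := by rw [(hz.pow_right 2).eq.symm]; group

/-- Under the same relations `d ^ 5` commutes with `x`. -/
theorem commute_pow_five_s7 (hz : Commute (x ^ 2) d)
    (h : d ^ 3 * x * d ^ 3 = x ^ 3 * d ^ 2 * x) : Commute (d ^ 5) x := by
  have hsolve := mul_cube_mul_cube_mul hz h
  have h6 : Commute (x ^ 6) (d ^ 3) := by
    simpa [← pow_mul] using hz.pow_pow 3 3
  have hleft : (x * d ^ 3) ^ 3 = x ^ 6 * d ^ 5 :=
    calc (x * d ^ 3) ^ 3 = x * d ^ 3 * x * d ^ 3 * x * d ^ 3 := by simp [pow_succ, mul_assoc]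
      _ = x ^ 6 * d ^ 5 := by rw [hsolve]; group
  have hright : (d ^ 3 * x) ^ 3 = x ^ 6 * d ^ 5 :=
    calc (d ^ 3 * x) ^ 3 = d ^ 3 * (x * d ^ 3 * x * d ^ 3 * x) := by simp [pow_succ, mul_assoc]
      _ = x ^ 6 * d ^ 3 * d ^ 2 := by rw [hsolve, ← mul_assoc, h6.eq]
      _ = x ^ 6 * d ^ 5 := by group
  have hshift : (x * d ^ 3) ^ 3 * x = x * (d ^ 3 * x) ^ 3 := by
    simp [pow_succ, mul_assoc]
  rw [hleft, hright] at hshift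
  apply mul_left_cancel (a := x ^ 6)
  calc x ^ 6 * (d ^ 5 * x) = x * (x ^ 6 * d ^ 5) := by rw [← hshift, mul_assoc]
    _ = x ^ 6 * (x * d ^ 5) := by group

end TwoGenerators

section Relations

variable {G : Type*} [Group G] {a b c x d : G}

/-- The relations of `G_Hiii`, rewritten in the generators `d = cba` and `x = bd`. -/
theorem exists_generators (h₁ : a * b * a = b * a * b)
    (h₂ : b * c * b * a = c * b * a * c) (h₃ : c * b * a = a * c * b) :
    ∃ x d : G, a = (x ^ 2)⁻¹ * d ^ 3 ∧ b = x * d⁻¹ ∧ c = d⁻¹ * x ∧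
      Commute (x ^ 2) d ∧ d ^ 3 * x * d ^ 3 = x ^ 3 * d ^ 2 * x := by
  obtain ⟨d, hd⟩ : ∃ d, d = c * b * a := ⟨_, rfl⟩
  have hbd : b * d = d * c := by rw [hd, ← h₂]; group
  have had : Commute a d := by
    change a * d = d * a
    rw [hd]; nth_rewrite 2 [h₃]; group
  obtain ⟨x, hx⟩ : ∃ x, x = b * d := ⟨_, rfl⟩
  have hb : b = x * d⁻¹ := by rw [hx]; group
  have hc : c = d⁻¹ * x := by rw [hx, hbd]; group
  have hxx : x ^ 2 * a = d ^ 3 :=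
    calc x ^ 2 * a = d * c * b * (d * a) := by rw [pow_two]; nth_rewrite 1 [hx, hbd]; rw [hx]; group
      _ = d * (c * b * a) * d := by rw [← had.eq]; group
      _ = d ^ 3 := by rw [← hd]; simp [pow_succ, mul_assoc]
  have hz : Commute (x ^ 2) d := by
    rw [eq_mul_inv_of_mul_eq hxx]
    exact ((Commute.refl d).pow_left 3).mul_left had.inv_left
  have ha : a = (x ^ 2)⁻¹ * d ^ 3 := eq_inv_mul_of_mul_eq hxx
  refine ⟨x, d, ha, hb, hc, hz, ?_⟩
  have hzx : Commute (x ^ 2) x := (Commute.refl x).pow_left 2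
  have hza : Commute (x ^ 2) a := by
    rw [ha]
    exact (Commute.refl (x ^ 2)).inv_right.mul_right (hz.pow_right 3)
  have hzb : Commute (x ^ 2) b := by rw [hb]; exact hzx.mul_right hz.inv_right
  calc d ^ 3 * x * d ^ 3 = x ^ 2 * a * (b * d) * d ^ 3 := by rw [hxx, ← hx]
    _ = x ^ 2 * (a * b * (d ^ 3 * d)) := by group
    _ = x ^ 2 * (a * b * x ^ 2 * a * d) := by rw [← hxx]; group
    _ = x ^ 2 * (x ^ 2 * (a * b) * a * d) := by rw [(hza.mul_right hzb).eq]
    _ = x ^ 2 * (x ^ 2 * (b * a * b) * d) := by rw [h₁.symm]; group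
    _ = x ^ 2 * (x ^ 2 * b * a * x) := by rw [hx]; group
    _ = x ^ 2 * (b * (x ^ 2 * a) * x) := by rw [hzb.eq]; group
    _ = x ^ 3 * d ^ 2 * x := by rw [hxx, hb]; group

theorem mul_inv_mul_inv_mul_mul_cube (hz : Commute (x ^ 2) d)
    (h : d ^ 3 * x * d ^ 3 = x ^ 3 * d ^ 2 * x) :
    x * d⁻¹ * (d⁻¹ * x) * d ^ 3 = (d ^ 3)⁻¹ * x ^ 5 := by
  have hw := (commute_pow_five_s7 hz h).inv_left
  have h6 : Commute (x ^ 6) (d ^ 2) := by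
    simpa [← pow_mul] using hz.pow_pow 3 2
  calc x * d⁻¹ * (d⁻¹ * x) * d ^ 3
      = x * (d ^ 5)⁻¹ * d ^ 3 * x * d ^ 3 := by group
    _ = (d ^ 5)⁻¹ * (x * d ^ 3 * x * d ^ 3 * x) * x⁻¹ := by rw [← hw.eq]; group
    _ = (d ^ 5)⁻¹ * (d ^ 2 * x ^ 6) * x⁻¹ := by rw [mul_cube_mul_cube_mul hz h, h6.eq]
    _ = (d ^ 3)⁻¹ * x ^ 5 := by group

/-- The relations of `GHiii_relations` hold in every group satisfying the defining relations. -/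
theorem relations_of_defining_relations (h₁ : a * b * a = b * a * b)
    (h₂ : b * c * b * a = c * b * a * c) (h₃ : c * b * a = a * c * b) :
    b * c * a = c * b * c ∧ a * c * a = c * a * c ∧ a * a * c = b * a * a ∧
    a * c * c * b = b * c * a * a ∧ a ^ 5 = b ^ 5 ∧ b ^ 5 = c ^ 5 := by
  obtain ⟨x, d, ha, hb, hc, hz, h⟩ := exists_generators h₁ h₂ h₃
  have hw := commute_pow_five_s7 hz h
  have hbca := mul_inv_mul_inv_mul_mul_cube hz h
  have hzi : Commute (x ^ 2)⁻¹ d := hz.inv_left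
  have hzx : Commute (x ^ 2)⁻¹ x := ((Commute.refl x).pow_left 2).inv_left
  have had : Commute a d := by
    rw [ha]; exact hzi.mul_left ((Commute.refl d).pow_left 3)
  have ha' : a = d ^ 3 * (x ^ 2)⁻¹ := ha.trans (hzi.pow_right 3).eq
  have hdc : d * c * d⁻¹ = b := by rw [hb, hc]; group
  have hda : d * a * d⁻¹ = a := by rw [← had.eq]; group
  have ha5 : a ^ 5 = (x ^ 2)⁻¹ ^ 5 * (d ^ 5) ^ 3 := by
    rw [ha, (hzi.pow_right 3).mul_pow]; group
  have ha5x : Commute (a ^ 5) x := by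
    rw [ha5]; exact (hzx.pow_left 5).mul_left (hw.pow_left 3)
  have ha5b : Commute (a ^ 5) b := by
    rw [hb]; exact ha5x.mul_right (had.pow_left 5).inv_right
  have hab : a ^ 5 = b ^ 5 := by
    have hconj : (a * b) * a * (a * b)⁻¹ = b := by rw [h₁]; group
    rw [← hconj, conj_pow, ← (((Commute.refl a).pow_left 5).mul_right ha5b).eq]
    group
  refine ⟨?_, ?_, ?_, ?_, hab, ?_⟩
  · calc b * c * a = x * d⁻¹ * (d⁻¹ * x) * d ^ 3 * (x ^ 2)⁻¹ := by rw [ha', hb, hc]; group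
      _ = (d ^ 3)⁻¹ * x ^ 2 * x := by rw [hbca]; group
      _ = c * b * c := by
        rw [← ((hz.pow_right 3).inv_right).eq, hb, hc,
          show d⁻¹ * x * (x * d⁻¹) * (d⁻¹ * x) = d⁻¹ * x ^ 2 * (d ^ 2)⁻¹ * x by
            simp [pow_succ, mul_assoc],
          ← hz.inv_right.eq]
        group
  · apply (MulAut.conj d).injective
    simp only [map_mul, MulAut.conj_apply, hdc, hda, h₁]
  · calc a * a * c = (x ^ 2)⁻¹ * (d ^ 3 * (x ^ 2)⁻¹) * d ^ 2 * x := by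
          rw [ha, hc]; group
      _ = (x ^ 2)⁻¹ * (x ^ 2)⁻¹ * (d ^ 5 * x) := by rw [← (hzi.pow_right 3).eq]; group
      _ = x * ((x ^ 2)⁻¹ * ((x ^ 2)⁻¹ * d⁻¹)) * d ^ 6 := by rw [hw.eq]; group
      _ = x * d⁻¹ * (x ^ 2)⁻¹ * ((x ^ 2)⁻¹ * d ^ 3) * d ^ 3 := by
        rw [hzi.inv_right.eq, ← mul_assoc (x ^ 2)⁻¹ d⁻¹, hzi.inv_right.eq]; group
      _ = b * a * a := by
        rw [(hzi.pow_right 3).eq, ha, hb]; group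
  · calc a * c * c * b = (x ^ 2)⁻¹ * (d ^ 2 * x * d⁻¹) * x ^ 2 * d⁻¹ := by
          rw [ha, hb, hc]; simp [pow_succ, mul_assoc]
      _ = d ^ 2 * x * d⁻¹ * d⁻¹ := by
        rw [(((hzi.pow_right 2).mul_right hzx).mul_right hzi.inv_right).eq]; group
      _ = (d ^ 3)⁻¹ * (d ^ 5 * x) * (d ^ 2)⁻¹ := by group
      _ = (d ^ 3)⁻¹ * x ^ 5 * (x ^ 2)⁻¹ * (x ^ 2)⁻¹ * d ^ 3 := by rw [hw.eq]; group
      _ = x * d⁻¹ * (d⁻¹ * x) * (d ^ 3 * (x ^ 2)⁻¹) * ((x ^ 2)⁻¹ * d ^ 3) := by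
        rw [← hbca]; group
      _ = b * c * a * a := by rw [← ha', ← ha, ← hb, ← hc]
  · have hc' : c = d⁻¹ * b * d⁻¹⁻¹ := by rw [← hdc]; group
    rw [hc', conj_pow, ← hab, ← (had.pow_left 5).inv_right.eq]
    group

end Relations

open GHiii in
theorem GHiii_relations :
    b * c * a = c * b * c ∧ a * c * a = c * a * c ∧ a * a * c = b * a * a ∧
    a * c * c * b = b * c * a * a ∧ a ^ 5 = b ^ 5 ∧ b ^ 5 = c ^ 5 := by
  have h₁ : a * b * a = b * a * b := by
    apply mul_inv_eq_one.mp
    exact PresentedGroup.one_of_mem (rels := hiiiRels) (Or.inl rfl)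
  have h₂ : b * c * b * a = c * b * a * c := by
    apply mul_inv_eq_one.mp
    exact PresentedGroup.one_of_mem (rels := hiiiRels) (Or.inr (Or.inl rfl))
  have h₃ : c * b * a = a * c * b := by
    apply mul_inv_eq_one.mp
    exact PresentedGroup.one_of_mem (rels := hiiiRels) (Or.inr (Or.inr rfl))
  exact relations_of_defining_relations h₁ h₂ h₃
end

section
/- The group presented by three generators a, b, c subject to the relations a·b·a·b·a·b·a = b·a·b·a·b·a·b, a·b = b·c, and a·c = c·a is an infinite cyclic group, i.e., it is isomorphic to the additive group of integers ℤ. -/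
open FreeGroup in
/-- The relations `abababa = bababab`, `ab = bc`, `ac = ca` of `G_Hviii`. -/
def hviiiRels : Set (FreeGroup HGen) :=
  { of .a * of .b * of .a * of .b * of .a * of .b * of .a *
      (of .b * of .a * of .b * of .a * of .b * of .a * of .b)⁻¹,
    of .a * of .b * (of .b * of .c)⁻¹,
    of .a * of .c * (of .c * of .a)⁻¹ }

section Group

variable {G : Type*} [Group G] {b x₀ x₁ x₂ x₃ : G}

/-- An equation between elements transfers along conjugation. -/
theorem SemiconjBy.eq_of_eq {u v u' v' : G} (hu : SemiconjBy b u' u) (hv : SemiconjBy b v' v)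
    (h : u = v) : u' = v' := by
  subst h
  exact mul_left_cancel (hu.eq.trans hv.eq.symm)

/-- If conjugation by `b` shifts `x₀, x₁, x₂, x₃` and neighbours commute, the dihedral Artin
relation of length seven between `x₀` and `b` takes a short form. -/
theorem mul_eq_mul_of_artin_seven (h₀ : SemiconjBy b x₁ x₀) (h₁ : SemiconjBy b x₂ x₁)
    (h₂ : SemiconjBy b x₃ x₂) (hc₀ : Commute x₀ x₁) (hc₂ : Commute x₂ x₃)
    (h : x₀ * b * x₀ * b * x₀ * b * x₀ = b * x₀ * b * x₀ * b * x₀ * b) :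
    x₁ * b = x₃ * x₀ := by
  have e₁ : x₁ = b⁻¹ * x₀ * b := by rw [mul_assoc, ← h₀.eq]; group
  have e₂ : x₂ = b⁻¹ * x₁ * b := by rw [mul_assoc, ← h₁.eq]; group
  have e₃ : x₃ = b⁻¹ * x₂ * b := by rw [mul_assoc, ← h₂.eq]; group
  have key : x₃ * x₂ * x₁ * x₀ = b * (x₃ * x₂) * x₁ := by
    apply mul_left_cancel (a := b * b * b)
    calc b * b * b * (x₃ * x₂ * x₁ * x₀) = x₀ * b * x₀ * b * x₀ * b * x₀ := by
          rw [e₃, e₂, e₁]; group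
      _ = b * x₀ * b * x₀ * b * x₀ * b := h
      _ = b * b * b * (b * (x₃ * x₂) * x₁) := by rw [e₃, e₂, e₁]; group
  apply mul_left_cancel (a := x₂)
  apply mul_right_cancel (b := x₁)
  calc x₂ * (x₁ * b) * x₁ = x₂ * x₁ * b * x₁ := by group
    _ = x₃ * x₂ * x₁ * x₀ := by rw [← (h₂.mul_right h₁).eq, key]
    _ = x₂ * (x₃ * x₀) * x₁ := by
      rw [← hc₂.eq, mul_assoc _ x₁, ← hc₀.eq]; group

theorem mul_eq_mul_of_semiconjBy (h₀ : SemiconjBy b x₁ x₀) (h₂ : SemiconjBy b x₃ x₂)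
    (hc₀ : Commute x₀ x₁) (hc₁ : Commute x₁ x₂) (hc₂ : Commute x₂ x₃)
    (h : x₁ * b = x₃ * x₀) : x₀ * x₃ = x₃ * x₁ ∧ x₂ * x₀ = x₀ * x₃ := by
  constructor
  · apply mul_right_cancel (b := x₀)
    calc x₀ * x₃ * x₀ = x₀ * x₁ * b := by rw [mul_assoc, ← h, mul_assoc]
      _ = x₁ * b * x₁ := by rw [hc₀.eq, mul_assoc, ← h₀.eq, mul_assoc]
      _ = x₃ * x₁ * x₀ := by rw [h, mul_assoc, hc₀.eq, mul_assoc]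
  · apply mul_left_cancel (a := x₃)
    calc x₃ * (x₂ * x₀) = x₂ * x₁ * b := by rw [mul_assoc, h, ← mul_assoc, ← mul_assoc, hc₂.eq]
      _ = x₁ * b * x₃ := by rw [← hc₁.eq, mul_assoc, ← h₂.eq, mul_assoc]
      _ = x₃ * (x₀ * x₃) := by rw [h, mul_assoc]

/-- In a group, elements `a`, `b` satisfying the dihedral Artin relation of length seven are equal
as soon as `a` commutes with its conjugate by `b`. -/
theorem eq_of_artin_seven_of_commute {a c : G}
    (h : a * b * a * b * a * b * a = b * a * b * a * b * a * b)
    (hac : a * b = b * c) (hcomm : Commute a c) : a = b := by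
  have shift (x : G) : SemiconjBy b (b⁻¹ * x * b) x := by
    simp [SemiconjBy, mul_assoc]
  have s₀ : SemiconjBy b c a := hac.symm
  obtain ⟨x₂, s₁⟩ : ∃ x₂, SemiconjBy b x₂ c := ⟨_, shift c⟩
  obtain ⟨x₃, s₂⟩ : ∃ x₃, SemiconjBy b x₃ x₂ := ⟨_, shift x₂⟩
  obtain ⟨x₄, s₃⟩ : ∃ x₄, SemiconjBy b x₄ x₃ := ⟨_, shift x₃⟩
  obtain ⟨x₅, s₄⟩ : ∃ x₅, SemiconjBy b x₅ x₄ := ⟨_, shift x₄⟩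
  have c₁ : Commute c x₂ := (s₀.mul_right s₁).eq_of_eq (s₁.mul_right s₀) hcomm
  have c₂ : Commute x₂ x₃ := (s₁.mul_right s₂).eq_of_eq (s₂.mul_right s₁) c₁
  have c₃ : Commute x₃ x₄ := (s₂.mul_right s₃).eq_of_eq (s₃.mul_right s₂) c₂
  have c₄ : Commute x₄ x₅ := (s₃.mul_right s₄).eq_of_eq (s₄.mul_right s₃) c₃
  have sb : SemiconjBy b b b := Commute.refl b
  have f₀ : c * b = x₃ * a := mul_eq_mul_of_artin_seven s₀ s₁ s₂ hcomm c₂ h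
  have f₁ : x₂ * b = x₄ * c := (s₁.mul_right sb).eq_of_eq (s₃.mul_right s₀) f₀
  have f₂ : x₃ * b = x₅ * x₂ := (s₂.mul_right sb).eq_of_eq (s₄.mul_right s₁) f₁
  obtain ⟨k₀, l₀⟩ := mul_eq_mul_of_semiconjBy s₀ s₂ hcomm c₁ c₂ f₀
  obtain ⟨k₁, l₁⟩ := mul_eq_mul_of_semiconjBy s₁ s₃ c₁ c₂ c₃ f₁
  obtain ⟨k₂, l₂⟩ := mul_eq_mul_of_semiconjBy s₂ s₄ c₂ c₃ c₄ f₂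
  have period : x₅ = a := by
    apply mul_right_cancel (b := x₃)
    rw [← k₂, ← l₂, ← k₁, ← l₁, ← k₀]
  rw [period] at c₄
  have hb : b * x₄ = a * a := by
    apply mul_left_cancel (a := x₂)
    calc x₂ * (b * x₄) = x₄ * (c * x₄) := by rw [← mul_assoc, f₁, mul_assoc]
      _ = x₄ * (x₂ * a) := by rw [l₀, k₀, l₁]
      _ = x₂ * (a * a) := by rw [← mul_assoc, ← k₁, ← l₁, ← k₀, ← l₀, mul_assoc]
  have hab : Commute a b := by
    rw [eq_mul_inv_of_mul_eq hb]
    exact ((Commute.refl a).mul_right (Commute.refl a)).mul_right c₄.symm.inv_right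
  have shift_eq {x : G} (hx : SemiconjBy b x a) : x = a := hx.eq_of_eq hab.symm rfl
  obtain rfl := shift_eq s₀
  obtain rfl := shift_eq s₁
  obtain rfl := shift_eq s₂
  exact (mul_left_cancel f₀).symm

end Group

/-- The group presented by `⟨a,b,c | abababa = bababab, ab = bc, ac = ca⟩` is infinite
cyclic, i.e. isomorphic to `ℤ`. -/
theorem GHviii_infinite_cyclic :
    Nonempty (PresentedGroup hviiiRels ≃* Multiplicative ℤ) := by
  let g : HGen → PresentedGroup hviiiRels := PresentedGroup.of
  have rel {u v : FreeGroup HGen} (h : u * v⁻¹ ∈ hviiiRels) :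
      PresentedGroup.mk hviiiRels u = PresentedGroup.mk hviiiRels v :=
    PresentedGroup.mk_eq_mk_of_mul_inv_mem h
  have hab : g .a = g .b := eq_of_artin_seven_of_commute (c := g .c)
    (rel (.inl rfl)) (rel (.inr (.inl rfl))) (rel (.inr (.inr rfl)))
  have hac : g .a = g .c := by
    have h : g .a * g .b = g .b * g .c := rel (.inr (.inl rfl))
    rw [hab] at h ⊢
    exact mul_left_cancel h
  have hf : ∀ r ∈ hviiiRels,
      FreeGroup.lift (fun _ : HGen => Multiplicative.ofAdd (1 : ℤ)) r = 1 := by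
    rintro r (rfl | rfl | rfl) <;> simp
  refine ⟨MonoidHom.toMulEquiv (PresentedGroup.toGroup hf) (zpowersHom _ (g .a)) ?_ ?_⟩
  · ext x
    cases x
    · simp [g]
    · simpa [g] using hab
    · simpa [g] using hac
  · ext
    simp [g]
end

section
/- The monoid G_Bii⁺ admits neither the left-divisibility theory nor the right-divisibility theory; that is, it is NOT the case that every pair of elements of G_Bii⁺ has a left least common multiple, and it is NOT the case that every pair of elements of G_Bii⁺ has a right least common multiple. -/
/-- The three generators. -/
inductive Gen3 : Type
  | a | b | c

open FreeGroup in
/-- The defining relations of `G_Bii`. -/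
def theRels : Set (FreeGroup Gen3) :=
  { of .a * of .b * of .a * of .b * of .a * of .b *
      (of .b * of .a * of .b * of .a * of .b * of .a)⁻¹,
    of .b * of .c * (of .a * of .b)⁻¹,
    of .a * of .c * (of .c * of .a)⁻¹ }

/-- The group `G_Bii`. -/
abbrev G : Type := PresentedGroup theRels

/-- The monoid `G_Bii⁺`: the submonoid of `G_Bii` generated by the images of `a, b, c`. -/
abbrev Gplus : Submonoid G :=
  Submonoid.closure {PresentedGroup.of Gen3.a, PresentedGroup.of Gen3.b, PresentedGroup.of Gen3.c}

section GroupIdentities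

variable {H : Type*} [Group H] {a b c : H}

/-- The conjugates of `a` under powers of `b` commute pairwise, and `b ^ 3` centralizes `a`. -/
theorem conj_eq_of_relations (h₁ : a * b * a * b * a * b = b * a * b * a * b * a)
    (h₂ : b * c = a * b) (h₃ : a * c = c * a) :
    ∃ d : H, c * b = b * d ∧ d * b = b * a ∧ c * d = d * c ∧ a * d = d * a := by
  obtain ⟨d, hd⟩ : ∃ d, c * b = b * d := ⟨b⁻¹ * (c * b), by group⟩
  obtain ⟨e, he⟩ : ∃ e, d * b = b * e := ⟨b⁻¹ * (d * b), by group⟩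
  have hcd : c * d = d * c := by
    apply mul_left_cancel (a := b)
    calc b * (c * d) = a * (b * d) := by rw [← mul_assoc, h₂, mul_assoc]
      _ = a * c * b := by rw [← hd, mul_assoc]
      _ = c * (a * b) := by rw [h₃, mul_assoc]
      _ = b * (d * c) := by rw [← h₂, ← mul_assoc, hd, mul_assoc]
  have hde : d * e = e * d := by
    apply mul_left_cancel (a := b)
    calc b * (d * e) = c * (b * e) := by rw [← mul_assoc, ← hd, mul_assoc]
      _ = c * d * b := by rw [← he, mul_assoc]
      _ = d * (c * b) := by rw [hcd, mul_assoc]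
      _ = b * (e * d) := by rw [hd, ← mul_assoc, he, mul_assoc]
  have left : a * b * a * b * a * b = b * b * b * (d * (e * c)) := by
    calc a * b * a * b * a * b = (a * b) * (a * b) * (a * b) := by group
      _ = b * (c * b) * (c * b) * c := by rw [← h₂]; group
      _ = b * b * (d * b) * d * c := by rw [hd]; group
      _ = b * b * b * (e * d) * c := by rw [he]; group
      _ = b * b * b * (d * (e * c)) := by rw [← hde]; group
  have right : b * a * b * a * b * a = b * b * b * (d * (a * c)) := by
    calc b * a * b * a * b * a = b * (a * b) * (a * b) * a := by group
      _ = b * b * (c * b) * (c * a) := by rw [← h₂]; group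
      _ = b * b * b * (d * (a * c)) := by rw [hd, h₃]; group
  have hea : e = a := by
    rw [left, right] at h₁
    exact mul_right_cancel (mul_left_cancel (mul_left_cancel h₁))
  subst hea
  exact ⟨d, hd, he, hcd, hde.symm⟩

end GroupIdentities

namespace PresentedGroup

/-- The defining relations, as equations in `G`. -/
theorem gen_relations :
    (of .a * of .b * of .a * of .b * of .a * of .b : G) =
        of .b * of .a * of .b * of .a * of .b * of .a ∧
      (of .b * of .c : G) = of .a * of .b ∧ (of .a * of .c : G) = of .c * of .a := by
  refine ⟨?_, ?_, ?_⟩ <;> rw [← mul_inv_eq_one]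
  · exact one_of_mem (rels := theRels) (Or.inl rfl)
  · exact one_of_mem (rels := theRels) (Or.inr (Or.inl rfl))
  · exact one_of_mem (rels := theRels) (Or.inr (Or.inr rfl))

end PresentedGroup

/-- The pair `(k, v)` stands for `b ^ k` times the product of the `(b⁻ⁱ a bⁱ) ^ v i`. -/
abbrev NormalForm : Type := ℤ × (ZMod 3 → ℤ)

/-- Left multiplication by `b⁻ʲ a bʲ` on normal forms. -/
def shiftAt (j : ZMod 3) : Equiv.Perm NormalForm where
  toFun p := (p.1, p.2 + Pi.single (j + p.1) 1)
  invFun p := (p.1, p.2 - Pi.single (j + p.1) 1)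
  left_inv p := by simp
  right_inv p := by simp

/-- Left multiplication by `b` on normal forms. -/
def advance : Equiv.Perm NormalForm where
  toFun p := (p.1 + 1, p.2)
  invFun p := (p.1 - 1, p.2)
  left_inv p := by simp
  right_inv p := by simp

/-- Left multiplication by a generator on normal forms. -/
def genAction : Gen3 → Equiv.Perm NormalForm
  | .a => shiftAt 0
  | .b => advance
  | .c => shiftAt 1

theorem genAction_relations : ∀ r ∈ theRels, FreeGroup.lift genAction r = 1 := by
  have h3 : (3 : ZMod 3) = 0 := rfl
  rintro r (rfl | rfl | rfl) <;>
    simp only [map_mul, map_inv, FreeGroup.lift_apply_of, mul_inv_eq_one] <;>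
    refine Equiv.ext fun p => Prod.ext ?_ ?_
  all_goals simp [genAction, shiftAt, advance]
  · have h (x : ZMod 3) : x + 1 + 1 + 1 = x := by linear_combination h3
    simp only [h]; abel
  · ring_nf
  · abel

/-- The action of `G` on normal forms by left multiplication. -/
def action : G →* Equiv.Perm NormalForm := PresentedGroup.toGroup genAction_relations

@[simp] theorem action_a (p : NormalForm) :
    action (PresentedGroup.of .a) p = (p.1, p.2 + Pi.single (p.1 : ZMod 3) 1) := by
  simp [action, genAction, shiftAt]

@[simp] theorem action_b (p : NormalForm) :
    action (PresentedGroup.of .b) p = (p.1 + 1, p.2) := by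
  simp [action, genAction, advance]

@[simp] theorem action_c (p : NormalForm) :
    action (PresentedGroup.of .c) p = (p.1, p.2 + Pi.single (1 + (p.1 : ZMod 3)) 1) := by
  simp [action, genAction, shiftAt]

/-- Positive elements act with nonnegative exponents, and `b⁻² a b²` cannot occur without `b`. -/
theorem exists_action_eq_of_mem_Gplus {g : G} (hg : g ∈ Gplus) :
    ∃ (n : ℕ) (u : ZMod 3 → ℕ), (n = 0 → u 2 = 0) ∧
      ∀ p : NormalForm, action g p = (p.1 + n, p.2 + fun i => (u (i - p.1) : ℤ)) := by
  induction hg using Submonoid.closure_induction with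
  | mem x hx =>
    rcases hx with rfl | rfl | rfl
    · refine ⟨0, Pi.single 0 1, fun _ => rfl, fun p => ?_⟩
      simp only [action_a]
      refine Prod.ext (by simp) (funext fun i => ?_)
      simp [Pi.single_apply, sub_eq_zero]
    · exact ⟨1, 0, fun _ => rfl, fun p => by ext <;> simp⟩
    · refine ⟨0, Pi.single 1 1, fun _ => rfl, fun p => ?_⟩
      simp only [action_c]
      refine Prod.ext (by simp) (funext fun i => ?_)
      simp [Pi.single_apply, sub_eq_iff_eq_add]
  | one => exact ⟨0, 0, fun _ => rfl, fun p => by ext <;> simp⟩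
  | mul x y _ _ hx hy =>
    obtain ⟨n, u, hu, hx⟩ := hx
    obtain ⟨m, w, hw, hy⟩ := hy
    refine ⟨n + m, fun i => w i + u (i - m), fun h => ?_, fun p => ?_⟩
    · obtain ⟨rfl, rfl⟩ : n = 0 ∧ m = 0 := by omega
      simp [hu, hw]
    · rw [map_mul, Equiv.Perm.mul_apply, hy, hx]
      refine Prod.ext (by simp; ring) (funext fun i => ?_)
      simp [sub_sub, add_assoc]

namespace Gplus

/-- The generator `a`. -/
def a : Gplus := ⟨PresentedGroup.of .a, Submonoid.subset_closure (by simp)⟩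

/-- The generator `b`. -/
def b : Gplus := ⟨PresentedGroup.of .b, Submonoid.subset_closure (by simp)⟩

/-- The generator `c`. -/
def c : Gplus := ⟨PresentedGroup.of .c, Submonoid.subset_closure (by simp)⟩

theorem identities :
    c * b * b = b * b * a ∧ c * b * c * b = b * c * b * a ∧ b * a * b * a = c * b * a * b := by
  obtain ⟨h₁, h₂, h₃⟩ := PresentedGroup.gen_relations
  obtain ⟨d, hcb, hdb, hcd, had⟩ := conj_eq_of_relations h₁ h₂ h₃
  refine ⟨Subtype.ext ?_, Subtype.ext ?_, Subtype.ext ?_⟩ <;>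
    simp only [a, b, c, Submonoid.coe_mul]
  · rw [hcb, mul_assoc, hdb, mul_assoc]
  · rw [hcb, mul_assoc _ d, ← hcd, mul_assoc, mul_assoc _ d, hdb]
    simp only [mul_assoc]
  · rw [mul_assoc (_ * _), ← hdb, hcb, mul_assoc _ d, ← had, hdb]
    simp only [mul_assoc, hdb]

/-- `b` and `c * b` have no left least common multiple. -/
theorem no_left_lcm (m w₁ w₂ w₃ w₄ : Gplus) (h₁ : m = b * w₁) (h₂ : m = c * b * w₂)
    (h₃ : c * b * b = m * w₃) (h₄ : c * b * c * b = m * w₄) : False := by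
  obtain ⟨N, U, -, hm⟩ := exists_action_eq_of_mem_Gplus m.2
  obtain ⟨n₁, u₁, hu₁, hw₁⟩ := exists_action_eq_of_mem_Gplus w₁.2
  obtain ⟨n₂, u₂, hu₂, hw₂⟩ := exists_action_eq_of_mem_Gplus w₂.2
  obtain ⟨n₃, u₃, hu₃, hw₃⟩ := exists_action_eq_of_mem_Gplus w₃.2
  obtain ⟨n₄, u₄, hu₄, hw₄⟩ := exists_action_eq_of_mem_Gplus w₄.2
  have act {x y : Gplus} (h : x = y) : action (x : G) 0 = action (y : G) 0 := by rw [h]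
  replace h₁ := act h₁
  replace h₂ := act h₂
  replace h₃ := act h₃
  replace h₄ := act h₄
  simp [b, c, hm, hw₁, hw₂, hw₃, hw₄, Prod.ext_iff] at h₁ h₂ h₃ h₄
  obtain ⟨k₁, f₁⟩ := h₁
  obtain ⟨k₂, f₂⟩ := h₂
  obtain ⟨k₃, f₃⟩ := h₃
  obtain ⟨k₄, f₄⟩ := h₄
  replace f₁ := congrFun f₁ 2
  replace f₂ := congrFun f₂ 2
  replace f₃ := congrFun f₃ 2
  replace f₄ := congrFun f₄ 2
  obtain ⟨rfl, rfl, rfl⟩ | ⟨rfl, rfl, rfl⟩ :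
      (N = 1 ∧ n₁ = 0 ∧ n₂ = 0) ∨ (N = 2 ∧ n₃ = 0 ∧ n₄ = 0) := by omega
  · have h : (1 + 1 : ZMod 3) = 2 := rfl
    simp [h] at f₁ f₂
    omega
  · have h : (1 + 2 : ZMod 3) = 0 := rfl
    have h₁₁ : (1 + 1 : ZMod 3) = 2 := rfl
    have h₂₀ : (2 : ZMod 3) ≠ 0 := by decide
    simp [h, h₁₁, h₂₀] at f₃ f₄
    omega

/-- `b` and `b * a` have no right least common multiple. -/
theorem no_right_lcm (m w₁ w₂ w₃ w₄ : Gplus) (h₁ : m = w₁ * b) (h₂ : m = w₂ * (b * a))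
    (h₃ : b * b * a = w₃ * m) (h₄ : b * a * b * a = w₄ * m) : False := by
  obtain ⟨N, U, -, hm⟩ := exists_action_eq_of_mem_Gplus m.2
  obtain ⟨n₁, u₁, hu₁, hw₁⟩ := exists_action_eq_of_mem_Gplus w₁.2
  obtain ⟨n₂, u₂, hu₂, hw₂⟩ := exists_action_eq_of_mem_Gplus w₂.2
  obtain ⟨n₃, u₃, hu₃, hw₃⟩ := exists_action_eq_of_mem_Gplus w₃.2
  obtain ⟨n₄, u₄, hu₄, hw₄⟩ := exists_action_eq_of_mem_Gplus w₄.2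
  have act {x y : Gplus} (h : x = y) : action (x : G) 0 = action (y : G) 0 := by rw [h]
  replace h₁ := act h₁
  replace h₂ := act h₂
  replace h₃ := act h₃
  replace h₄ := act h₄
  simp [a, b, hm, hw₁, hw₂, hw₃, hw₄, Prod.ext_iff] at h₁ h₂ h₃ h₄
  obtain ⟨k₁, f₁⟩ := h₁
  obtain ⟨k₂, f₂⟩ := h₂
  obtain ⟨k₃, f₃⟩ := h₃
  obtain ⟨k₄, f₄⟩ := h₄
  replace f₁ := congrFun f₁ 0
  replace f₂ := congrFun f₂ 0
  replace f₃ := congrFun f₃ 1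
  replace f₄ := congrFun f₄ 1
  obtain ⟨rfl, rfl, rfl⟩ | ⟨rfl, rfl, rfl⟩ :
      (N = 1 ∧ n₁ = 0 ∧ n₂ = 0) ∨ (N = 2 ∧ n₃ = 0 ∧ n₄ = 0) := by omega
  · have h : (-1 : ZMod 3) = 2 := rfl
    simp [h] at f₁ f₂
    omega
  · have h : (1 - 2 : ZMod 3) = 2 := rfl
    simp [h] at f₃ f₄
    omega

end Gplus

/-- `G_Bii⁺` admits neither the left- nor the right-divisibility theory: it is not
the case that any two elements have a left least common multiple, nor that any two
elements have a right least common multiple. -/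
theorem Gplus_no_divisibility_theory :
    (¬ ∀ x y : Gplus, ∃ m : Gplus,
        (∃ w : Gplus, m = x * w) ∧ (∃ w : Gplus, m = y * w) ∧
        ∀ n : Gplus, (∃ w : Gplus, n = x * w) → (∃ w : Gplus, n = y * w) →
          ∃ w : Gplus, n = m * w) ∧
    (¬ ∀ x y : Gplus, ∃ m : Gplus,
        (∃ w : Gplus, m = w * x) ∧ (∃ w : Gplus, m = w * y) ∧
        ∀ n : Gplus, (∃ w : Gplus, n = w * x) → (∃ w : Gplus, n = w * y) →
          ∃ w : Gplus, n = w * m) := by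

  obtain ⟨e₁, e₂, e₃⟩ := Gplus.identities
  constructor
  · intro h
    obtain ⟨m, ⟨w₁, h₁⟩, ⟨w₂, h₂⟩, hmin⟩ := h Gplus.b (Gplus.c * Gplus.b)
    obtain ⟨w₃, h₃⟩ := hmin (Gplus.c * Gplus.b * Gplus.b)
      ⟨Gplus.b * Gplus.a, by rw [e₁, mul_assoc]⟩ ⟨Gplus.b, rfl⟩
    obtain ⟨w₄, h₄⟩ := hmin (Gplus.c * Gplus.b * Gplus.c * Gplus.b)
      ⟨Gplus.c * Gplus.b * Gplus.a, by rw [e₂]; simp only [mul_assoc]⟩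
      ⟨Gplus.c * Gplus.b, by simp only [mul_assoc]⟩
    exact Gplus.no_left_lcm m w₁ w₂ w₃ w₄ h₁ h₂ h₃ h₄
  · intro h
    obtain ⟨m, ⟨w₁, h₁⟩, ⟨w₂, h₂⟩, hmin⟩ := h Gplus.b (Gplus.b * Gplus.a)
    obtain ⟨w₃, h₃⟩ := hmin (Gplus.b * Gplus.b * Gplus.a)
      ⟨Gplus.c * Gplus.b, e₁.symm⟩ ⟨Gplus.b, by rw [mul_assoc]⟩
    obtain ⟨w₄, h₄⟩ := hmin (Gplus.b * Gplus.a * Gplus.b * Gplus.a)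
      ⟨Gplus.c * Gplus.b * Gplus.a, e₃⟩ ⟨Gplus.b * Gplus.a, by simp only [mul_assoc]⟩
    exact Gplus.no_right_lcm m w₁ w₂ w₃ w₄ h₁ h₂ h₃ h₄
end

section
/- Let l, u, v be complex numbers with l^6 = 1, u ≠ 0, and v ≠ 0, and define the 2×2 complex matrices A := u·[[1, l^2],[0, 1]], B := v·[[l, 0],[0, l⁻¹]], and C := u·[[1, 1],[0, 1]]. Then C·B·B = B·B·A, B·C = A·B, and A·C = C·A (so a ↦ A, b ↦ B, c ↦ C induces a representation of the group presented by ⟨a,b,c | cbb = bba, bc = ab, ac = ca⟩ into GL(2,ℂ)). Moreover, if l^2 ≠ 1 then A·B ≠ B·A, so the image of this representation is not abelian. -/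
open Matrix

/-- The matrices `A = u·[[1,l²],[0,1]]`, `B = v·[[l,0],[0,l⁻¹]]`, `C = u·[[1,1],[0,1]]`
satisfy the defining relations `cbb = bba`, `bc = ab`, `ac = ca` of `G_Bii`, giving a
representation `G_Bii → GL(2,ℂ)`, whose image is non-abelian when `l² ≠ 1`. -/
theorem GBii_matrix_representation (l u v : ℂ) (hl : l ^ 6 = 1) (hu : u ≠ 0) (hv : v ≠ 0)
    (A : Matrix (Fin 2) (Fin 2) ℂ) (B : Matrix (Fin 2) (Fin 2) ℂ) (C : Matrix (Fin 2) (Fin 2) ℂ)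
    (hA : A = u • !![1, l ^ 2; 0, 1])
    (hB : B = v • !![l, 0; 0, l⁻¹])
    (hC : C = u • !![1, 1; 0, 1]) :
    C * B * B = B * B * A ∧ B * C = A * B ∧ A * C = C * A ∧
    (l ^ 2 ≠ 1 → A * B ≠ B * A) := by
  have hl0 : l ≠ 0 := by
    rintro rfl
    norm_num at hl
  have hinv : l⁻¹ = l ^ 5 := inv_eq_of_mul_eq_one_right (by linear_combination hl)
  subst hA hB hC
  rw [hinv]
  refine ⟨?_, ?_, ?_, fun h hAB => h ?_⟩
  · ext i j
    fin_cases i <;> fin_cases j <;> simp [Matrix.mul_apply, Fin.sum_univ_two] <;>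
      first | ring1 | linear_combination u * v ^ 2 * l ^ 4 * hl
  · ext i j
    fin_cases i <;> fin_cases j <;> simp [Matrix.mul_apply, Fin.sum_univ_two] <;>
      first | ring1 | linear_combination -u * v * l * hl
  · ext i j
    fin_cases i <;> fin_cases j <;> simp [Matrix.mul_apply, Fin.sum_univ_two] <;> ring
  · have h01 := congrFun (congrFun hAB 0) 1
    simp only [Matrix.mul_apply, Fin.sum_univ_two, Matrix.smul_apply, smul_eq_mul,
      Matrix.of_apply, Matrix.cons_val', Matrix.cons_val_zero, Matrix.cons_val_one] at h01
    refine mul_left_cancel₀ (mul_ne_zero (mul_ne_zero hu hv) hl0) ?_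
    linear_combination u * v * l * hl - h01
end

section
/- Let l, b, c be complex numbers with l^10 = 1 and l^2 ≠ 1, and with b·c = (−l^4 + l^2 − 1)/(1 − l^2)^2. Set a := −1/(l·(l^2 − 1)), d := l^3/(l^2 − 1), and define the 2×2 complex matrices A := [[l, 0],[0, l⁻¹]], B := [[a, b],[c, d]], and C := [[−l^4·a, −b/l^4],[−l^4·c, −d/l^4]]. Then A·B·A = B·A·B, A·C·A = B·A·C, and A·C·A·C·A = C·A·C·A·C (so a ↦ A, b ↦ B, c ↦ C induces a representation of the group presented by ⟨a,b,c | aba = bab, aca = bac, acaca = cacac⟩ into GL(2,ℂ)). Moreover A·B ≠ B·A, so the image of this representation is not abelian. -/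
open Matrix

/-- Matrix representation of `G_Bvi = ⟨a,b,c | aba = bab, aca = bac, acaca = cacac⟩`
into `GL(2,ℂ)`, with non-abelian image. -/
theorem GBvi_matrix_representation (l b c : ℂ) (hl : l ^ 10 = 1) (hl2 : l ^ 2 ≠ 1)
    (hbc : b * c = (-l ^ 4 + l ^ 2 - 1) / (1 - l ^ 2) ^ 2)
    (a d : ℂ) (ha : a = -1 / (l * (l ^ 2 - 1))) (hd : d = l ^ 3 / (l ^ 2 - 1))
    (A B C : Matrix (Fin 2) (Fin 2) ℂ)
    (hA : A = !![l, 0; 0, l⁻¹])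
    (hB : B = !![a, b; c, d])
    (hC : C = !![-l ^ 4 * a, -b / l ^ 4; -l ^ 4 * c, -d / l ^ 4]) :
    A * B * A = B * A * B ∧ A * C * A = B * A * C ∧
    A * C * A * C * A = C * A * C * A * C ∧ A * B ≠ B * A := by
  have hl0 : l ≠ 0 := by rintro rfl; norm_num at hl
  have hq : l ^ 2 - 1 ≠ 0 := sub_ne_zero.mpr hl2
  have hcyc : l ^ 8 + l ^ 6 + l ^ 4 + l ^ 2 + 1 = 0 :=
    mul_left_cancel₀ hq (by linear_combination hl)
  obtain ⟨m, hm⟩ : ∃ m, m = l⁻¹ := ⟨_, rfl⟩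
  obtain ⟨u, hu⟩ : ∃ u, u = (l ^ 2 - 1)⁻¹ := ⟨_, rfl⟩
  have hlm : l * m = 1 := by rw [hm, mul_inv_cancel₀ hl0]
  have hqu : (l ^ 2 - 1) * u = 1 := by rw [hu, mul_inv_cancel₀ hq]
  have ha' : a = -(m * u) := by rw [ha, hm, hu]; field_simp
  have hd' : d = l ^ 3 * u := by rw [hd, hu, div_eq_mul_inv]
  have hbc' : b * c = (-l ^ 4 + l ^ 2 - 1) * u ^ 2 := by
    rw [hbc, hu, div_eq_mul_inv, inv_pow, ← neg_sub (l ^ 2) 1, neg_sq]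
  have hb4 : -b / l ^ 4 = -b * m ^ 4 := by rw [hm, inv_pow, div_eq_mul_inv]
  have hd4 : -d / l ^ 4 = -d * m ^ 4 := by rw [hm, inv_pow, div_eq_mul_inv]
  rw [hb4, hd4] at hC
  rw [← hm] at hA
  have hABA : A * B * A = B * A * B := by
    subst hA hB
    ext i j
    fin_cases i <;> fin_cases j <;> simp [Matrix.mul_apply, Fin.sum_univ_two] <;>
      clear hC ha hd hbc hm hu hb4 hd4 hl <;> grind
  refine ⟨hABA, ?_, ?_, ?_⟩
  · have hCB : C = B * !![-l ^ 4, 0; 0, -m ^ 4] := by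
      subst hB hC
      ext i j
      fin_cases i <;> fin_cases j <;> simp [Matrix.mul_apply, Fin.sum_univ_two, mul_comm]
    have hcomm : !![-l ^ 4, 0; 0, -m ^ 4] * A = A * !![-l ^ 4, 0; 0, -m ^ 4] := by
      subst hA
      ext i j
      fin_cases i <;> fin_cases j <;> simp [Matrix.mul_apply, Fin.sum_univ_two, mul_comm]
    rw [hCB, ← Matrix.mul_assoc, ← Matrix.mul_assoc, ← hABA, Matrix.mul_assoc (A * B), hcomm,
      ← Matrix.mul_assoc]
  · have hlm5 : m ^ 5 = l ^ 5 := by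
      linear_combination (-m ^ 5) * hl +
        l ^ 5 * ((l * m) ^ 4 + (l * m) ^ 3 + (l * m) ^ 2 + l * m + 1) * hlm
    have hCA : C * A = -l ^ 5 • B := by
      subst hA hB hC
      ext i j
      fin_cases i <;> fin_cases j <;> simp [Matrix.mul_apply, Fin.sum_univ_two] <;>
        clear hABA ha hd hbc hm hu hb4 hd4 hl <;> grind
    have hABB : A * B * B = B * B * C := by
      have hm' : m = l ^ 9 := by linear_combination (-m) * hl + l ^ 9 * hlm
      subst hA hB hC
      ext i j
      fin_cases i <;> fin_cases j <;> simp [Matrix.mul_apply, Fin.sum_univ_two] <;>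
        clear hABA ha hd hbc hm hu hb4 hd4 hl hCA <;> grind
    have hl5 : -l ^ 5 * -l ^ 5 = 1 := by linear_combination hl
    calc A * C * A * C * A = A * (C * A) * (C * A) := by simp only [Matrix.mul_assoc]
      _ = A * B * B := by
        simp only [hCA, Matrix.mul_smul, Matrix.smul_mul, smul_smul, hl5, one_smul]
      _ = B * B * C := hABB
      _ = (C * A) * (C * A) * C := by
        simp only [hCA, Matrix.mul_smul, Matrix.smul_mul, smul_smul, hl5, one_smul]
      _ = C * A * C * A * C := by simp only [Matrix.mul_assoc]
  · intro h
    have h01 := congrFun (congrFun h 0) 1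
    simp [hA, hB, Matrix.mul_apply, Fin.sum_univ_two] at h01
    have hb : b = 0 := by
      refine (mul_eq_zero.mp (?_ : (l ^ 2 - 1) * b = 0)).resolve_left hq
      linear_combination l * h01 + b * hlm
    have hq3 : l ^ 4 - l ^ 2 + 1 = 0 := by
      rw [hb, zero_mul] at hbc'
      linear_combination (l ^ 2 - 1) ^ 2 * hbc' -
        (l ^ 4 - l ^ 2 + 1) * ((l ^ 2 - 1) * u + 1) * hqu
    grind
end

section
/- Let l, p, b be complex numbers with l^2 − l + 1 = 0, 3·p^2 − 3·p + 2 = 0, and b ≠ 0. Set a := (l + 1)/3, d := (−l + 2)/3, c := −2/(3·b), q := b·(−l + 2)/(3·p), r := −p·(l + 1)/(3·b), s := 2/(3·p), and define the 2×2 complex matrices A := [[l, 0],[0, l⁻¹]], B := [[a, b],[c, d]], and C := [[p, q],[r, s]]. Then A·B·A·B = B·A·B·A, A·C·A = B·A·C, and A·C·A·C·A = C·A·C·A·C (so a ↦ A, b ↦ B, c ↦ C induces a representation of the group presented by ⟨a,b,c | abab = baba, aca = bac, acaca = cacac⟩ into GL(2,ℂ)). Moreover A·B ≠ B·A, so the image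 of this representation is not abelian. -/
open Matrix

/-- Matrix representation of `G_Hii = ⟨a,b,c | abab = baba, aca = bac, acaca = cacac⟩`
into `GL(2,ℂ)`, with non-abelian image. -/
theorem GHii_matrix_representation (l p b : ℂ)
    (hl : l ^ 2 - l + 1 = 0) (hp : 3 * p ^ 2 - 3 * p + 2 = 0) (hb : b ≠ 0)
    (a d c q r s : ℂ)
    (ha : a = (l + 1) / 3) (hd : d = (-l + 2) / 3) (hc : c = -2 / (3 * b))
    (hq : q = b * (-l + 2) / (3 * p)) (hr : r = -p * (l + 1) / (3 * b)) (hs : s = 2 / (3 * p))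
    (A B C : Matrix (Fin 2) (Fin 2) ℂ)
    (hA : A = !![l, 0; 0, l⁻¹])
    (hB : B = !![a, b; c, d])
    (hC : C = !![p, q; r, s]) :
    A * B * A * B = B * A * B * A ∧ A * C * A = B * A * C ∧
    A * C * A * C * A = C * A * C * A * C ∧ A * B ≠ B * A := by
  have hp0 : p ≠ 0 := by rintro rfl; norm_num at hp
  have hli : l⁻¹ = 1 - l := inv_eq_of_mul_eq_one_right (by grind)
  have hs' : s = 1 - p := by rw [hs]; field_simp; grind
  have hq' : q = b * (2 - l) * (1 - p) / 2 := by rw [hq]; field_simp; grind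
  obtain ⟨u, hu⟩ : ∃ u, b * u = 1 := ⟨b⁻¹, mul_inv_cancel₀ hb⟩
  have hc' : c = -2 / 3 * u := by rw [hc]; field_simp; grind
  have hr' : r = -p * (l + 1) / 3 * u := by rw [hr]; field_simp; grind
  rw [hli] at hA
  clear hc hr hq hs hli
  subst hs' hq' hc' hr' ha hd hA hB hC
  refine ⟨?_, ?_, ?_, fun h ↦ ?_⟩
  · ext i j
    fin_cases i <;> fin_cases j <;> simp [Matrix.mul_apply, Fin.sum_univ_two] <;> grind
  · ext i j
    fin_cases i <;> fin_cases j <;> simp [Matrix.mul_apply, Fin.sum_univ_two] <;> grind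
  · ext i j
    fin_cases i <;> fin_cases j <;> simp [Matrix.mul_apply, Fin.sum_univ_two] <;> grind
  · have h01 := congrFun (congrFun h 0) 1
    simp [Matrix.mul_apply, Fin.sum_univ_two] at h01
    grind
end

section
/- Let l, b, c be complex numbers with l^10 = 1 and l^2 ≠ 1, and with b·c = (−l^4 + l^2 − 1)/(l^2 − 1)^2. Set a := −1/(l·(l^2 − 1)), d := l^3/(l^2 − 1), and define the 2×2 complex matrices A := [[l, 0],[0, l⁻¹]], B := [[a, b],[c, d]], and C := [[a, b/l^4],[l^4·c, d]]. Then A·B·A = B·A·B, B·C·B·A = C·B·A·C, and C·B·A = A·C·B (so a ↦ A, b ↦ B, c ↦ C induces a representation of the group presented by ⟨a,b,c | aba = bab, bcba = cbac, cba = acb⟩ into GL(2,ℂ)). Moreover A·B ≠ B·A, so the image of this representation is not abelian. -/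
open Matrix

/-- Matrix representation of `G_Hiii = ⟨a,b,c | aba = bab, bcba = cbac, cba = acb⟩`
into `GL(2,ℂ)`, with non-abelian image. -/
theorem GHiii_matrix_representation (l b c : ℂ) (hl : l ^ 10 = 1) (hl2 : l ^ 2 ≠ 1)
    (hbc : b * c = (-l ^ 4 + l ^ 2 - 1) / (l ^ 2 - 1) ^ 2)
    (a d : ℂ) (ha : a = -1 / (l * (l ^ 2 - 1))) (hd : d = l ^ 3 / (l ^ 2 - 1))
    (A B C : Matrix (Fin 2) (Fin 2) ℂ)
    (hA : A = !![l, 0; 0, l⁻¹])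
    (hB : B = !![a, b; c, d])
    (hC : C = !![a, b / l ^ 4; l ^ 4 * c, d]) :
    A * B * A = B * A * B ∧ B * C * B * A = C * B * A * C ∧
    C * B * A = A * C * B ∧ A * B ≠ B * A := by
  have hl0 : l ≠ 0 := by
    rintro rfl
    norm_num at hl
  have hl21 : l ^ 2 - 1 ≠ 0 := sub_ne_zero.mpr hl2
  have hcyc : l ^ 8 + l ^ 6 + l ^ 4 + l ^ 2 + 1 = 0 :=
    mul_left_cancel₀ hl21 (by linear_combination hl)
  have hinv : l⁻¹ = l ^ 9 := by
    field_simp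
    linear_combination -hl
  have hdiv : b / l ^ 4 = b * l ^ 6 := by
    field_simp
    linear_combination -b * hl
  have ha' : a * (l ^ 3 - l) = -1 := by
    rw [ha]
    field_simp
  have ha_poly : 5 * a = l ^ 9 * (4 + 3 * l ^ 2 + 2 * l ^ 4 + l ^ 6) := by
    clear hd hbc hA hB hC ha
    grind
  have hd' : d = -l ^ 4 * a := by
    rw [hd, ha]
    field_simp
  have hbc' : b * c = l ^ 2 * a ^ 2 * (-l ^ 4 + l ^ 2 - 1) := by
    rw [hbc, ha]
    field_simp
  have hbc0 : b * c ≠ 0 := by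
    intro h
    rw [hbc, div_eq_zero_iff, or_iff_left (pow_ne_zero 2 hl21)] at h
    grind
  clear hbc ha hd
  rw [hdiv] at hC
  rw [hinv] at hA
  subst hA hB hC hd'
  refine ⟨?_, ?_, ?_, fun h => ?_⟩
  · ext i j
    fin_cases i <;> fin_cases j <;> simp [Matrix.mul_apply, Fin.sum_univ_two] <;>
      clear hl2 hl0 hl21 hinv hdiv hbc0 <;> grind
  · ext i j
    fin_cases i <;> fin_cases j <;> simp [Matrix.mul_apply, Fin.sum_univ_two] <;>
      clear hl2 hl0 hl21 hinv hdiv hbc0 <;> grind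
  · ext i j
    fin_cases i <;> fin_cases j <;> simp [Matrix.mul_apply, Fin.sum_univ_two] <;>
      clear hl2 hl0 hl21 hinv hdiv hbc0 <;> grind
  · have h01 := congrFun (congrFun h 0) 1
    simp [Matrix.mul_apply, Fin.sum_univ_two] at h01
    grind
end
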